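/- arXiv:1207.6464 — 2 statements merged into one kernel-verified Lean document; each statement's English description precedes it below -/
import Mathlib

section
/- Let n ≥ 1 be an integer and b, d real numbers such that there exists k ∈ {0,…,n−1} with k−1 < d < k and n−k−1 < b < n−k (i.e. (d,b) belongs to the lower staircase region E_n^−). Then D^n_{b,d}(z) → −∞ as z → 0+. -/
/-- `f b ν z = Ψ(b, b+1-ν, z)`, the Tricomi confluent hypergeometric function,
given by its integral representation. -/
noncomputable def tricomiF (b ν z : ℝ) : ℝ :=
  (1 / Real.Gamma b) * ∫ t in Set.Ioi (0:ℝ), Real.exp (-t * z) * t ^ (b - 1) * (1 + t) ^ (-ν)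

/-- The weighted Hankel determinant
`D^n_{b,d}(z) = det[(d-n+j)_i f_{b,d-n+i+j}(z)]_{0 ≤ i,j ≤ n}`. -/
noncomputable def hankelD (n : ℕ) (b d z : ℝ) : ℝ :=
  Matrix.det (Matrix.of fun i j : Fin (n+1) =>
    (ascPochhammer ℝ (i : ℕ)).eval (d - (n : ℝ) + (j : ℕ)) *
      tricomiF b (d - (n : ℝ) + (i : ℕ) + (j : ℕ)) z)

open Filter

section

open MeasureTheory Set

lemma integrableOn_exp_neg_mul_rpow {b r : ℝ} (hb : 0 < b) (hr : 0 < r) :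
    IntegrableOn (fun t : ℝ => Real.exp (-t * r) * t ^ (b - 1)) (Ioi 0) := by
  have h := integrableOn_rpow_mul_exp_neg_mul_rpow (p := 1) (s := b - 1) (b := r)
    (by linarith) one_pos hr
  refine h.congr_fun (fun t _ => ?_) measurableSet_Ioi
  simp only [Real.rpow_one]
  rw [mul_comm, show -t * r = -r * t by ring]

lemma one_add_rpow_le {p t : ℝ} (hp : 0 ≤ p) (ht : 0 ≤ t) :
    (1 + t) ^ p ≤ 2 ^ p * (1 + t ^ p) := by
  have htp : 0 ≤ t ^ p := Real.rpow_nonneg ht p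
  have h2 : (0 : ℝ) ≤ 2 ^ p := by positivity
  rcases le_total t 1 with h | h
  · calc (1 + t) ^ p ≤ 2 ^ p := Real.rpow_le_rpow (by linarith) (by linarith) hp
      _ ≤ _ := by nlinarith
  · calc (1 + t) ^ p ≤ (2 * t) ^ p := Real.rpow_le_rpow (by linarith) (by linarith) hp
      _ = 2 ^ p * t ^ p := Real.mul_rpow (by norm_num) ht
      _ ≤ _ := by nlinarith

lemma integrableOn_exp_neg_mul_rpow_mul_one_add {b p r : ℝ} (hb : 0 < b) (hp : 0 ≤ p)
    (hr : 0 < r) :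
    IntegrableOn (fun t : ℝ => Real.exp (-t * r) * t ^ (b - 1) * (2 ^ p * (1 + t ^ p)))
      (Ioi 0) := by
  have h1 := (integrableOn_exp_neg_mul_rpow hb hr).const_mul (2 ^ p)
  have h2 := (integrableOn_exp_neg_mul_rpow (add_pos_of_pos_of_nonneg hb hp) hr).const_mul (2 ^ p)
  refine IntegrableOn.congr_fun (h1.add h2) (fun t ht => ?_) measurableSet_Ioi
  have ht : 0 < t := ht
  simp only [Pi.add_apply]
  rw [show b + p - 1 = (b - 1) + p by ring, Real.rpow_add ht]
  ring

lemma integrableOn_tricomi_kernel {b z : ℝ} (ν : ℝ) (hb : 0 < b) (hz : 0 < z) :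
    IntegrableOn (fun t : ℝ => Real.exp (-t * z) * t ^ (b - 1) * (1 + t) ^ (-ν)) (Ioi 0) := by
  refine Integrable.mono (integrableOn_exp_neg_mul_rpow_mul_one_add hb (abs_nonneg ν) hz)
    (by fun_prop) ?_
  refine (ae_restrict_iff' measurableSet_Ioi).2 (ae_of_all _ fun t ht => ?_)
  have ht : 0 < t := ht
  rw [Real.norm_of_nonneg (by positivity), Real.norm_of_nonneg (by positivity)]
  gcongr
  calc (1 + t) ^ (-ν) ≤ (1 + t) ^ |ν| :=
        Real.rpow_le_rpow_of_exponent_le (by linarith) (neg_le_abs ν)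
    _ ≤ _ := one_add_rpow_le (abs_nonneg ν) ht.le

/-- The Gamma integral with one power of the variable shifted by `z`. -/
noncomputable def shiftedGamma (b ν z : ℝ) : ℝ :=
  ∫ s in Ioi (0 : ℝ), Real.exp (-s) * s ^ (b - 1) * (z + s) ^ (-ν)

lemma tendsto_shiftedGamma {b ν : ℝ} (hb : 0 < b) (hν : ν < b) :
    Tendsto (shiftedGamma b ν) (nhdsWithin 0 (Ioi 0)) (nhds (Real.Gamma (b - ν))) := by
  have hz1 : ∀ᶠ z : ℝ in nhdsWithin 0 (Ioi 0), z ∈ Ioo (0 : ℝ) 1 :=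
    Ioo_mem_nhdsGT one_pos
  have hlim : Real.Gamma (b - ν)
      = ∫ s in Ioi (0 : ℝ), Real.exp (-s) * s ^ (b - 1) * (0 + s) ^ (-ν) := by
    rw [Real.Gamma_eq_integral (by linarith)]
    refine setIntegral_congr_fun measurableSet_Ioi fun s (hs : 0 < s) => ?_
    simp only [zero_add]
    rw [mul_assoc, ← Real.rpow_add hs]
    ring_nf
  obtain ⟨bound, hbound, hle⟩ : ∃ bound : ℝ → ℝ, IntegrableOn bound (Ioi 0) ∧
      ∀ z ∈ Ioo (0 : ℝ) 1, ∀ s : ℝ, 0 < s →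
        Real.exp (-s) * s ^ (b - 1) * (z + s) ^ (-ν) ≤ bound s := by
    rcases le_total ν 0 with h | h
    · refine ⟨_, integrableOn_exp_neg_mul_rpow_mul_one_add hb (neg_nonneg.2 h) one_pos,
        fun z hz s hs => ?_⟩
      rw [mul_one]
      gcongr
      refine (Real.rpow_le_rpow (by linarith [hz.1]) (by linarith [hz.2]) (neg_nonneg.2 h)).trans
        (one_add_rpow_le (neg_nonneg.2 h) hs.le)
    · refine ⟨_, integrableOn_exp_neg_mul_rpow (sub_pos.2 hν) one_pos, fun z hz s hs => ?_⟩
      rw [mul_one, show b - ν - 1 = (b - 1) + -ν by ring, Real.rpow_add hs, ← mul_assoc]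
      gcongr ?_ * ?_
      exact Real.rpow_le_rpow_of_nonpos hs (by linarith [hz.1]) (by linarith)
  rw [hlim]
  refine tendsto_integral_filter_of_dominated_convergence bound
    (Eventually.of_forall fun z => by fun_prop) ?_ hbound ?_
  · filter_upwards [hz1] with z hz
    refine (ae_restrict_iff' measurableSet_Ioi).2 (ae_of_all _ fun s hs => ?_)
    have hs : 0 < s := hs
    have := hz.1
    rw [Real.norm_of_nonneg (by positivity)]
    exact hle z hz s hs
  · refine (ae_restrict_iff' measurableSet_Ioi).2 (ae_of_all _ fun s hs => ?_)
    have hs : 0 < s := hs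
    have hc : ContinuousAt (fun z : ℝ => Real.exp (-s) * s ^ (b - 1) * (z + s) ^ (-ν)) 0 := by
      refine ContinuousAt.mul continuousAt_const (ContinuousAt.rpow_const (by fun_prop) ?_)
      left; simpa using hs.ne'
    exact hc.tendsto.mono_left nhdsWithin_le_nhds

lemma tricomiF_eq_rpow_mul_shiftedGamma {b z : ℝ} (ν : ℝ) (hz : 0 < z) :
    tricomiF b ν z = z ^ (ν - b) * shiftedGamma b ν z / Real.Gamma b := by
  have h := integral_comp_mul_left_Ioi' (E := ℝ)
    (fun s : ℝ => Real.exp (-s) * s ^ (b - 1) * (z + s) ^ (-ν)) 0 hz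
  rw [mul_zero] at h
  rw [tricomiF, shiftedGamma, ← h, smul_eq_mul, ← mul_assoc, one_div, ← div_eq_inv_mul,
    ← integral_const_mul]
  congr 1
  refine setIntegral_congr_fun measurableSet_Ioi fun t ht => ?_
  have ht : 0 < t := ht
  have e : z + z * t = z * (1 + t) := by ring
  rw [e, Real.mul_rpow hz.le ht.le, Real.mul_rpow hz.le (by positivity)]
  have : z ^ (ν - b) * z * z ^ (b - 1) * z ^ (-ν) = 1 := by
    rw [← Real.rpow_add_one hz.ne', ← Real.rpow_add hz, ← Real.rpow_add hz]
    ring_nf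
    exact Real.rpow_zero z
  rw [show -(z * t) = -t * z by ring]
  linear_combination (-(Real.exp (-t * z) * t ^ (b - 1) * (1 + t) ^ (-ν))) * this

lemma tricomiF_eq_shiftedGamma_div {b ν z : ℝ} (hb : 0 < b) (hν : 0 < ν) (hz : 0 < z) :
    tricomiF b ν z = shiftedGamma ν b z / Real.Gamma ν := by
  have hGb := Real.Gamma_pos_of_pos hb
  have hGν := Real.Gamma_pos_of_pos hν
  set K : ℝ → ℝ → ℝ := fun t s =>
    (Real.exp (-t * z) * t ^ (b - 1)) * (Real.exp (-s * 1) * s ^ (ν - 1)) * Real.exp (-(t * s))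
    with hK
  have hint : Integrable (Function.uncurry K)
      ((volume.restrict (Ioi 0)).prod (volume.restrict (Ioi 0))) := by
    refine Integrable.mono (Integrable.mul_prod (integrableOn_exp_neg_mul_rpow hb hz)
      (integrableOn_exp_neg_mul_rpow hν one_pos)) ?_ ?_
    · apply Measurable.aestronglyMeasurable
      simp only [hK, Function.uncurry_def]
      fun_prop
    · rw [Measure.prod_restrict]
      refine (ae_restrict_iff' (measurableSet_Ioi.prod measurableSet_Ioi)).2
        (ae_of_all _ fun p hp => ?_)
      have h1 : 0 < p.1 := hp.1
      have h2 : 0 < p.2 := hp.2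
      rw [Function.uncurry_def, norm_mul]
      refine mul_le_of_le_one_right (norm_nonneg _) ?_
      rw [Real.norm_of_nonneg (by positivity)]
      exact Real.exp_le_one_iff.2 (by nlinarith)
  have key := integral_integral_swap hint
  have hL : ∀ t ∈ Ioi (0 : ℝ), ∫ s in Ioi (0 : ℝ), K t s
      = Real.Gamma ν * (Real.exp (-t * z) * t ^ (b - 1) * (1 + t) ^ (-ν)) := by
    intro t ht
    have ht : 0 < t := ht
    have h := Real.integral_rpow_mul_exp_neg_mul_Ioi hν (by linarith : 0 < 1 + t)
    rw [one_div, Real.inv_rpow (by positivity), ← Real.rpow_neg (by positivity)] at h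
    calc ∫ s in Ioi (0 : ℝ), K t s
        = ∫ s in Ioi (0 : ℝ), (Real.exp (-t * z) * t ^ (b - 1)) *
            (s ^ (ν - 1) * Real.exp (-((1 + t) * s))) := by
          congr 1; ext s
          simp only [hK]
          rw [show -((1 + t) * s) = -s * 1 + -(t * s) by ring, Real.exp_add]; ring
      _ = _ := by rw [integral_const_mul, h]; ring
  have hR : ∀ s ∈ Ioi (0 : ℝ), ∫ t in Ioi (0 : ℝ), K t s
      = Real.Gamma b * (Real.exp (-s) * s ^ (ν - 1) * (z + s) ^ (-b)) := by
    intro s hs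
    have hs : 0 < s := hs
    have h := Real.integral_rpow_mul_exp_neg_mul_Ioi hb (by linarith : 0 < z + s)
    rw [one_div, Real.inv_rpow (by positivity), ← Real.rpow_neg (by positivity)] at h
    calc ∫ t in Ioi (0 : ℝ), K t s
        = ∫ t in Ioi (0 : ℝ), (Real.exp (-s) * s ^ (ν - 1)) *
            (t ^ (b - 1) * Real.exp (-((z + s) * t))) := by
          congr 1; ext t
          simp only [hK]
          rw [show -((z + s) * t) = -t * z + -(t * s) by ring, Real.exp_add, mul_one]; ring
      _ = _ := by rw [integral_const_mul, h]; ring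
  rw [setIntegral_congr_fun measurableSet_Ioi hL, setIntegral_congr_fun measurableSet_Ioi hR,
    integral_const_mul, integral_const_mul] at key
  rw [tricomiF, shiftedGamma, one_div, ← div_eq_inv_mul, div_eq_div_iff hGb.ne' hGν.ne']
  linarith

/-- For `b < ν` the function `tricomiF b ν` has a finite limit at the origin. -/
lemma tendsto_tricomiF_of_lt {b ν : ℝ} (hb : 0 < b) (h : b < ν) :
    Tendsto (tricomiF b ν) (nhdsWithin 0 (Ioi 0))
      (nhds (Real.Gamma (ν - b) / Real.Gamma ν)) := by
  refine ((tendsto_shiftedGamma (hb.trans h) h).div_const _).congr' ?_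
  filter_upwards [self_mem_nhdsWithin] with z hz
  exact (tricomiF_eq_shiftedGamma_div hb (hb.trans h) hz).symm

/-- For `ν < b` the function `tricomiF b ν` blows up like `z ^ (ν - b)` at the origin. -/
lemma tendsto_rpow_mul_tricomiF_of_gt {b ν : ℝ} (hb : 0 < b) (h : ν < b) :
    Tendsto (fun z => z ^ (b - ν) * tricomiF b ν z) (nhdsWithin 0 (Ioi 0))
      (nhds (Real.Gamma (b - ν) / Real.Gamma b)) := by
  refine ((tendsto_shiftedGamma hb h).div_const _).congr' ?_
  filter_upwards [self_mem_nhdsWithin] with z hz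
  rw [tricomiF_eq_rpow_mul_shiftedGamma ν hz, ← mul_div_assoc, ← mul_assoc,
    ← Real.rpow_add hz, show b - ν + (ν - b) = 0 by ring, Real.rpow_zero, one_mul]

lemma tricomiF_nonneg {b ν z : ℝ} (hb : 0 < b) : 0 ≤ tricomiF b ν z := by
  have := Real.Gamma_pos_of_pos hb
  refine mul_nonneg (by positivity) (setIntegral_nonneg measurableSet_Ioi fun t ht => ?_)
  have ht : 0 < t := ht
  positivity

lemma tricomiF_anti {b ν ν' z : ℝ} (hb : 0 < b) (hz : 0 < z) (h : ν ≤ ν') :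
    tricomiF b ν' z ≤ tricomiF b ν z := by
  have := Real.Gamma_pos_of_pos hb
  refine mul_le_mul_of_nonneg_left (setIntegral_mono_on (integrableOn_tricomi_kernel ν' hb hz)
    (integrableOn_tricomi_kernel ν hb hz) measurableSet_Ioi fun t ht => ?_) (by positivity)
  have ht : 0 < t := ht
  gcongr
  linarith

lemma tendsto_rpow_nhdsGT_zero {θ : ℝ} (hθ : 0 < θ) :
    Tendsto (fun z : ℝ => z ^ θ) (nhdsWithin 0 (Ioi 0)) (nhds 0) := by
  have h := (Real.continuousAt_rpow_const 0 θ (Or.inr hθ.le)).tendsto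
  rw [Real.zero_rpow hθ.ne'] at h
  exact h.mono_left nhdsWithin_le_nhds

lemma tendsto_rpow_mul_tricomiF_zero {b ν θ : ℝ} (hb : 0 < b) (hθ : 0 < θ)
    (h : 0 < θ + (ν - b)) :
    Tendsto (fun z => z ^ θ * tricomiF b ν z) (nhdsWithin 0 (Ioi 0)) (nhds 0) := by
  have aux : ∀ ν' < b, 0 < θ + (ν' - b) →
      Tendsto (fun z => z ^ θ * tricomiF b ν' z) (nhdsWithin 0 (Ioi 0)) (nhds 0) := by
    intro ν' hν' h'
    have h1 := (tendsto_rpow_nhdsGT_zero h').mul (tendsto_rpow_mul_tricomiF_of_gt hb hν')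
    rw [zero_mul] at h1
    refine h1.congr' ?_
    filter_upwards [self_mem_nhdsWithin] with z hz
    rw [← mul_assoc, ← Real.rpow_add hz]
    ring_nf
  rcases lt_or_ge ν b with hν | hν
  · exact aux ν hν h
  · refine squeeze_zero' ?_ ?_ (aux (b - θ / 2) (by linarith) (by linarith))
    · filter_upwards [self_mem_nhdsWithin] with z hz
      have hz : 0 < z := hz
      exact mul_nonneg (by positivity) (tricomiF_nonneg hb)
    · filter_upwards [self_mem_nhdsWithin] with z hz
      have hz : 0 < z := hz
      exact mul_le_mul_of_nonneg_left (tricomiF_anti hb hz (by linarith)) (by positivity)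

lemma tendsto_tricomiF_self_atTop {b : ℝ} (hb : 0 < b) :
    Tendsto (tricomiF b b) (nhdsWithin 0 (Ioi 0)) atTop := by
  have hlim : Tendsto (fun ε : ℝ => Real.Gamma ε / Real.Gamma (b + ε))
      (nhdsWithin 0 (Ioi 0)) atTop := by
    have hc : ContinuousAt (fun ε : ℝ => Real.Gamma (ε + 1) / Real.Gamma (b + ε)) 0 := by
      refine ContinuousAt.div ?_ ?_ (by simpa using (Real.Gamma_pos_of_pos hb).ne')
      · refine ContinuousAt.comp (g := Real.Gamma) ?_ (by fun_prop)
        exact (Real.differentiableAt_Gamma fun m => by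
          have : (0 : ℝ) ≤ m := m.cast_nonneg
          linarith).continuousAt
      · refine ContinuousAt.comp (g := Real.Gamma) ?_ (by fun_prop)
        exact (Real.differentiableAt_Gamma fun m => by
          have : (0 : ℝ) ≤ m := m.cast_nonneg
          linarith).continuousAt
    have h1 := tendsto_inv_nhdsGT_zero.atTop_mul_pos (C := 1 / Real.Gamma b)
      (one_div_pos.2 (Real.Gamma_pos_of_pos hb))
      (by simpa using hc.tendsto.mono_left (nhdsWithin_le_nhds (s := Ioi (0 : ℝ))))
    refine h1.congr' ?_
    filter_upwards [self_mem_nhdsWithin] with ε hε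
    have hε : (ε : ℝ) ≠ 0 := ne_of_gt hε
    rw [Real.Gamma_add_one hε]
    field_simp
  refine tendsto_atTop.2 fun C => ?_
  obtain ⟨ε, hεC, hε⟩ := ((hlim.eventually_gt_atTop C).and self_mem_nhdsWithin).exists
  have hε : 0 < ε := hε
  have h2 := tendsto_tricomiF_of_lt hb (show b < b + ε by linarith)
  rw [add_sub_cancel_left] at h2
  filter_upwards [h2.eventually_const_lt hεC, self_mem_nhdsWithin] with z h3 hz
  exact h3.le.trans (tricomiF_anti hb hz (by linarith))

lemma Gamma_add_natCast {x : ℝ} (hx : ∀ m : ℕ, x ≠ -m) (n : ℕ) :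
    Real.Gamma (x + n) = (ascPochhammer ℝ n).eval x * Real.Gamma x := by
  induction n with
  | zero => simp
  | succ n ih =>
    have h : x + n ≠ 0 := fun h => hx n (by linarith)
    rw [ascPochhammer_succ_eval, Nat.cast_succ, ← add_assoc, Real.Gamma_add_one h, ih]
    ring

lemma ne_neg_natCast_of_pos {x : ℝ} (hx : 0 < x) (m : ℕ) : x ≠ -m := by
  have : (0 : ℝ) ≤ m := m.cast_nonneg
  linarith

lemma det_ascPochhammer_pos {m : ℕ} {v : Fin m → ℝ} (hv : StrictMono v) :
    0 < (Matrix.of fun i j : Fin m => (ascPochhammer ℝ (i : ℕ)).eval (v j)).det := by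
  have h := Matrix.det_eval_matrixOfPolynomials_eq_det_vandermonde v
    (fun i => ascPochhammer ℝ (i : ℕ)) (fun i => ascPochhammer_natDegree _ _)
    (fun i => monic_ascPochhammer _ _)
  rw [← Matrix.det_transpose]
  change 0 < (Matrix.of fun i j : Fin m => (ascPochhammer ℝ (j : ℕ)).eval (v i)).det
  rw [← h, Matrix.det_vandermonde]
  exact Finset.prod_pos fun i _ => Finset.prod_pos fun j hj =>
    sub_pos.2 (hv (Finset.mem_Ioi.1 hj))

lemma det_hankel_Gamma_pos {y : ℝ} (hy : 0 < y) (m : ℕ) :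
    0 < (Matrix.of fun i j : Fin m => Real.Gamma (y + (i : ℕ) + (j : ℕ))).det := by
  have h : (Matrix.of fun i j : Fin m => Real.Gamma (y + (i : ℕ) + (j : ℕ)))
      = Matrix.of fun i j : Fin m => Real.Gamma (y + (j : ℕ)) *
        (Matrix.of fun i j : Fin m => (ascPochhammer ℝ (i : ℕ)).eval (y + ((j : ℕ) : ℝ))) i j := by
    ext i j
    have hp : 0 < y + (j : ℕ) := by positivity
    simp only [Matrix.of_apply]
    rw [add_right_comm, Gamma_add_natCast (ne_neg_natCast_of_pos hp), mul_comm]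
  rw [h, Matrix.det_mul_row]
  refine mul_pos (Finset.prod_pos fun j _ => Real.Gamma_pos_of_pos (by positivity))
    (det_ascPochhammer_pos fun i j hij => ?_)
  have : ((i : ℕ) : ℝ) < (j : ℕ) := by exact_mod_cast hij
  linarith

lemma ascPochhammer_eval_succ_left (n : ℕ) (x : ℝ) :
    (ascPochhammer ℝ (n + 1)).eval x = x * (ascPochhammer ℝ n).eval (x + 1) := by
  simp [ascPochhammer_succ_left, Polynomial.eval_comp]

/-- The Chu-Vandermonde identity. -/
lemma sum_choose_mul_ascPochhammer (n : ℕ) (x y : ℝ) :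
    ∑ l ∈ Finset.range (n + 1), (n.choose l : ℝ) * (ascPochhammer ℝ l).eval x *
      (ascPochhammer ℝ (n - l)).eval y = (ascPochhammer ℝ n).eval (x + y) := by
  induction n generalizing x y with
  | zero => simp
  | succ n ih =>
    have h := Finset.sum_choose_succ_mul
      (fun l m => (ascPochhammer ℝ l).eval x * (ascPochhammer ℝ m).eval y) n
    simp only [← mul_assoc] at h
    rw [h, ascPochhammer_eval_succ_left]
    have h1 := ih x (y + 1)
    have h2 := ih (x + 1) y
    rw [show x + (y + 1) = x + y + 1 by ring] at h1
    rw [show x + 1 + y = x + y + 1 by ring] at h2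
    rw [add_mul]
    nth_rw 1 [← h2]
    rw [← h1, Finset.mul_sum, Finset.mul_sum, add_comm]
    congr 1
    · refine Finset.sum_congr rfl fun l _ => ?_
      rw [ascPochhammer_eval_succ_left]
      ring
    · refine Finset.sum_congr rfl fun l hl => ?_
      have hli : l ≤ n := Nat.lt_succ_iff.1 (Finset.mem_range.1 hl)
      rw [Nat.sub_add_comm hli, ascPochhammer_eval_succ_left]
      ring

lemma sum_choose_mul_ascPochhammer_mul_Gamma {i : ℕ} {x b : ℝ} (h : 0 < b - x - i)
    (hb : ∀ m : ℕ, b - i ≠ -m) :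
    ∑ l ∈ Finset.range (i + 1), (i.choose l : ℝ) *
      ((ascPochhammer ℝ l).eval x * (Real.Gamma (b - x - l) / Real.Gamma b))
      = Real.Gamma (b - x - i) / Real.Gamma (b - i) := by
  have hG : Real.Gamma b = (ascPochhammer ℝ i).eval (b - i) * Real.Gamma (b - i) := by
    rw [← Gamma_add_natCast hb, sub_add_cancel]
  have hG0 : Real.Gamma (b - i) ≠ 0 := Real.Gamma_ne_zero hb
  have hb' : Real.Gamma b ≠ 0 := Real.Gamma_ne_zero fun m hm => hb (m + i) (by
    rw [hm]; push_cast; ring)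
  have hV := sum_choose_mul_ascPochhammer i x (b - x - i)
  rw [show x + (b - x - i) = b - i by ring] at hV
  rw [eq_div_iff hG0]
  have : ∀ l ∈ Finset.range (i + 1), (i.choose l : ℝ) *
      ((ascPochhammer ℝ l).eval x * (Real.Gamma (b - x - l) / Real.Gamma b))
      = (i.choose l : ℝ) * (ascPochhammer ℝ l).eval x *
      (ascPochhammer ℝ (i - l)).eval (b - x - i) * (Real.Gamma (b - x - i) / Real.Gamma b) := by
    intro l hl
    have hli : l ≤ i := Nat.lt_succ_iff.1 (Finset.mem_range.1 hl)
    rw [show b - x - l = b - x - i + ((i - l : ℕ) : ℝ) by push_cast [hli]; ring,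
      Gamma_add_natCast (ne_neg_natCast_of_pos h)]
    ring
  rw [Finset.sum_congr rfl this, ← Finset.sum_mul, hV]
  rw [hG] at hb' ⊢
  have hP := left_ne_zero_of_mul hb'
  field_simp

/-- The determinant of the leading block, up to a positive factor. -/
lemma det_beta_block {b a : ℝ} {r : ℕ} (ha : ∀ p : ℕ, p + 2 ≤ 2 * r → a + p < 0)
    (hb : ∀ i m : ℕ, b - i ≠ -m) :
    ∃ c > 0, (Matrix.of fun i j : Fin r => (ascPochhammer ℝ (i : ℕ)).eval (a + b + (j : ℕ)) *
      (Real.Gamma (-(a + (i : ℕ) + (j : ℕ))) / Real.Gamma b)).det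
      = c * ∏ i ∈ Finset.range r, (Real.Gamma (b - i))⁻¹ := by
  rcases Nat.eq_zero_or_pos r with rfl | hr
  · exact ⟨1, one_pos, by simp⟩
  have hy : 0 < -(a + (2 * r - 2 : ℕ)) := neg_pos.2 (ha _ (by omega))
  refine ⟨_, det_hankel_Gamma_pos hy r, ?_⟩
  set M := Matrix.of fun i j : Fin r => (ascPochhammer ℝ (i : ℕ)).eval (a + b + (j : ℕ)) *
      (Real.Gamma (-(a + (i : ℕ) + (j : ℕ))) / Real.Gamma b) with hM
  set T : Matrix (Fin r) (Fin r) ℝ := Matrix.of fun i l => ((i : ℕ).choose (l : ℕ) : ℝ) with hT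
  have hTdet : T.det = 1 := by
    rw [Matrix.det_of_isLowerTriangular]
    · simp [hT]
    · intro i j hij
      have : (i : ℕ) < j := by simpa using hij
      simp [hT, Nat.choose_eq_zero_of_lt this]
  have hTM : T * M = Matrix.of fun i j : Fin r => (Real.Gamma (b - (i : ℕ)))⁻¹ *
      (Matrix.of fun i j : Fin r => Real.Gamma (-(a + (i : ℕ) + (j : ℕ)))) i j := by
    ext i j
    have hpos : 0 < b - (a + b + (j : ℕ)) - (i : ℕ) := by
      have := ha (i + j) (by omega)
      push_cast at this
      linarith
    have hs := sum_choose_mul_ascPochhammer_mul_Gamma hpos (hb i)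
    rw [Matrix.mul_apply]
    simp only [hT, hM, Matrix.of_apply]
    rw [← div_eq_inv_mul, show -(a + (i : ℕ) + (j : ℕ)) = b - (a + b + (j : ℕ)) - (i : ℕ) by ring,
      ← hs, Finset.sum_subset (Finset.range_subset_range.2 (show (i : ℕ) + 1 ≤ r by omega)),
      ← Fin.sum_univ_eq_sum_range (fun l => ((i : ℕ).choose l : ℝ) *
        ((ascPochhammer ℝ l).eval (a + b + (j : ℕ)) *
          (Real.Gamma (b - (a + b + (j : ℕ)) - l) / Real.Gamma b)))]
    · refine Finset.sum_congr rfl fun l _ => ?_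
      rw [show -(a + (l : ℕ) + (j : ℕ)) = b - (a + b + (j : ℕ)) - (l : ℕ) by ring]
    · intro l _ hl
      rw [Finset.mem_range] at hl
      simp [Nat.choose_eq_zero_of_lt (show (i : ℕ) < l by omega)]
  have hrev : (Matrix.of fun i j : Fin r => Real.Gamma (-(a + (i : ℕ) + (j : ℕ)))).det
      = (Matrix.of fun i j : Fin r =>
        Real.Gamma (-(a + (2 * r - 2 : ℕ)) + (i : ℕ) + (j : ℕ))).det := by
    rw [← Matrix.det_submatrix_equiv_self Fin.revPerm]
    congr 1
    ext i j
    simp only [Matrix.submatrix_apply, Matrix.of_apply, Fin.revPerm_apply, Fin.val_rev]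
    congr 1
    rw [Nat.cast_sub (by omega), Nat.cast_sub (by omega), Nat.cast_sub (by omega)]
    push_cast
    ring
  have hdet : M.det = (T * M).det := by rw [Matrix.det_mul, hTdet, one_mul]
  rw [hdet, hTM, Matrix.det_mul_column, hrev, mul_comm,
    Fin.prod_univ_eq_prod_range (fun i => (Real.Gamma (b - i))⁻¹)]

lemma det_of_upper_right_zero (F : ℕ → ℕ → ℝ) (p q : ℕ)
    (h : ∀ i j, i < p → p ≤ j → F i j = 0) :
    (Matrix.of fun i j : Fin (p + q) => F i j).det
      = (Matrix.of fun i j : Fin p => F i j).det *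
        (Matrix.of fun i j : Fin q => F (p + i) (p + j)).det := by
  rw [← Matrix.det_submatrix_equiv_self finSumFinEquiv,
    ← Matrix.det_fromBlocks_zero₁₂ _ (Matrix.of fun (i : Fin q) (j : Fin p) => F (p + i) j)]
  congr 1
  ext i j
  rcases i with i | i <;> rcases j with j | j <;> simp [h]

section Scaling

variable (b x : ℝ) (r e : ℕ)

/-- The scaling factor attached to the index `i` in the limit `z → 0`; the first `r` indices see
the singular part of `tricomiF`, the next `e` (zero or one) a logarithm, the others its regular
part. -/
noncomputable def scaleFactor (i : ℕ) (z : ℝ) : ℝ :=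
  if i < r then z ^ ((b - x) / 2 - i) else if i < r + e then (√(tricomiF b b z))⁻¹ else 1

/-- The limit of the scaled function `tricomiF b (x + i + j)`. -/
noncomputable def scaledLimit (i j : ℕ) : ℝ :=
  if i < r ∧ j < r then Real.Gamma (-(x - b + i + j)) / Real.Gamma b
  else if i < r ∨ j < r then 0
  else if i < r + e ∧ j < r + e then 1
  else if i < r + e ∨ j < r + e then 0
  else Real.Gamma (x - b + i + j) / Real.Gamma (x + i + j)

lemma scaledLimit_comm (i j : ℕ) : scaledLimit b x r e i j = scaledLimit b x r e j i := by
  simp only [scaledLimit, and_comm, or_comm, add_right_comm _ (i : ℝ)]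

variable {b x r e}

lemma tendsto_scaled_tricomiF_of_le (hb : 0 < b) (he : e ≤ 1)
    (hneg : ∀ p : ℕ, p + 2 ≤ 2 * r → x - b + p < 0) (hzero : e = 1 → x - b + 2 * r = 0)
    (hpos : 0 < x - b + 2 * (r + e)) {i j : ℕ} (hij : i ≤ j) :
    Tendsto (fun z => scaleFactor b x r e i z * scaleFactor b x r e j z *
      tricomiF b (x + i + j) z) (nhdsWithin 0 (Ioi 0)) (nhds (scaledLimit b x r e i j)) := by
  have hsqrt : Tendsto (fun z => (√(tricomiF b b z))⁻¹) (nhdsWithin 0 (Ioi 0)) (nhds 0) :=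
    (Real.tendsto_sqrt_atTop.comp (tendsto_tricomiF_self_atTop hb)).inv_tendsto_atTop
  have hreg : ∀ l : ℕ, r + e ≤ l → 0 < x - b + 2 * l := fun l hl => by
    have : ((r + e : ℕ) : ℝ) ≤ l := by exact_mod_cast hl
    push_cast at this
    linarith
  have hsing : i < r → x - b + 2 * i < 0 := fun h => by
    have := hneg (2 * i) (by omega)
    push_cast at this
    exact this
  have hmid : i < r + e → ¬ i < r → e = 1 ∧ i = r := by omega
  by_cases hir : i < r
  · have hθ := hsing hir
    by_cases hjr : j < r
    · have hν := hneg (i + j) (by omega)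
      push_cast at hν
      have h := tendsto_rpow_mul_tricomiF_of_gt hb (show x + i + j < b by linarith)
      simp only [scaleFactor, scaledLimit, hir, hjr, if_true, and_self]
      rw [show -(x - b + i + j) = b - (x + i + j) by ring]
      refine h.congr' ?_
      filter_upwards [self_mem_nhdsWithin] with z hz
      rw [← Real.rpow_add hz]
      ring_nf
    · by_cases hje : j < r + e
      · obtain ⟨he1, rfl⟩ : e = 1 ∧ j = r := by omega
        have hz := hzero he1
        have hij' : (i : ℝ) < j := by exact_mod_cast hir
        have h := hsqrt.mul (tendsto_rpow_mul_tricomiF_of_gt hb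
          (show x + i + j < b by linarith))
        rw [zero_mul] at h
        simp only [scaleFactor, scaledLimit, hir, hje, if_true, lt_irrefl, if_false, and_false,
          true_or]
        refine h.congr' (Eventually.of_forall fun z => ?_)
        simp only
        rw [show (b - x) / 2 - i = b - (x + i + j) by linarith]
        ring
      · have := hreg j (not_lt.1 hje)
        have h := tendsto_rpow_mul_tricomiF_zero hb (ν := x + i + j) (θ := (b - x) / 2 - i)
          (by linarith) (by linarith)
        simpa only [scaleFactor, scaledLimit, hir, hje, hjr, if_true, if_false, and_false, mul_one,
          true_or] using h
  · have hjr : ¬ j < r := by omega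
    by_cases hie : i < r + e
    · obtain ⟨he1, rfl⟩ := hmid hie hir
      have hz := hzero he1
      by_cases hje : j < i + e
      · obtain rfl : j = i := by omega
        simp only [scaleFactor, scaledLimit, hie, hir, if_true, if_false, and_self, or_self]
        refine tendsto_const_nhds.congr' ?_
        filter_upwards [(tendsto_tricomiF_self_atTop hb).eventually_gt_atTop 0] with z h0
        rw [show x + j + j = b by linarith, ← mul_inv, Real.mul_self_sqrt h0.le,
          inv_mul_cancel₀ h0.ne']
      · have hij' : (i : ℝ) < j := by
          have : i < j := by omega
          exact_mod_cast this
        have h := hsqrt.mul (tendsto_tricomiF_of_lt hb (show b < x + i + j by linarith))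
        rw [zero_mul] at h
        simpa only [scaleFactor, scaledLimit, hie, hir, hje, hjr, if_true, if_false, and_false,
          false_and, or_self, true_or, mul_one] using h
    · have hje : ¬ j < r + e := by omega
      have hij' : (i : ℝ) ≤ j := by exact_mod_cast hij
      have := hreg i (not_lt.1 hie)
      have h := tendsto_tricomiF_of_lt hb (show b < x + i + j by linarith)
      rw [show x + i + j - b = x - b + i + j by ring] at h
      simpa only [scaleFactor, scaledLimit, hie, hir, hje, hjr, if_false, and_self, or_self,
        one_mul] using h

lemma tendsto_scaled_tricomiF (hb : 0 < b) (he : e ≤ 1)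
    (hneg : ∀ p : ℕ, p + 2 ≤ 2 * r → x - b + p < 0) (hzero : e = 1 → x - b + 2 * r = 0)
    (hpos : 0 < x - b + 2 * (r + e)) (i j : ℕ) :
    Tendsto (fun z => scaleFactor b x r e i z * scaleFactor b x r e j z *
      tricomiF b (x + i + j) z) (nhdsWithin 0 (Ioi 0)) (nhds (scaledLimit b x r e i j)) := by
  rcases le_total i j with hij | hij
  · exact tendsto_scaled_tricomiF_of_le hb he hneg hzero hpos hij
  · rw [scaledLimit_comm]
    refine (tendsto_scaled_tricomiF_of_le hb he hneg hzero hpos hij).congr fun z => ?_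
    rw [add_right_comm, mul_comm (scaleFactor b x r e j z)]

lemma tendsto_scaleFactor (hb : 0 < b) (hneg : ∀ p : ℕ, p + 2 ≤ 2 * r → x - b + p < 0) (i : ℕ) :
    Tendsto (scaleFactor b x r e i) (nhdsWithin 0 (Ioi 0)) (nhds (if i < r + e then 0 else 1)) := by
  unfold scaleFactor
  by_cases hir : i < r
  · have := hneg (2 * i) (by omega)
    push_cast at this
    simpa only [hir, if_true, show i < r + e by omega] using
      tendsto_rpow_nhdsGT_zero (show 0 < (b - x) / 2 - i by linarith)
  · by_cases hie : i < r + e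
    · simp only [hir, hie, if_true, if_false]
      exact (Real.tendsto_sqrt_atTop.comp (tendsto_tricomiF_self_atTop hb)).inv_tendsto_atTop
    · simpa only [hir, hie, if_false] using tendsto_const_nhds

lemma eventually_scaleFactor_pos (hb : 0 < b) :
    ∀ᶠ z in nhdsWithin 0 (Ioi 0), ∀ i, 0 < scaleFactor b x r e i z := by
  filter_upwards [self_mem_nhdsWithin,
    (tendsto_tricomiF_self_atTop hb).eventually_gt_atTop 0] with z (hz : 0 < z) h0 i
  unfold scaleFactor
  split_ifs <;> positivity

lemma det_scaledLimit (hb : 0 < b) (hbn : ∀ i m : ℕ, b - i ≠ -m) (hxn : ∀ i m : ℕ, x + i ≠ -m)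
    (he : e ≤ 1) (hneg : ∀ p : ℕ, p + 2 ≤ 2 * r → x - b + p < 0)
    (hzero : e = 1 → x - b + 2 * r = 0) (hpos : 0 < x - b + 2 * (r + e)) (s : ℕ) :
    ∃ c > 0, (Matrix.of fun i j : Fin (r + e + s) =>
      (ascPochhammer ℝ (i : ℕ)).eval (x + (j : ℕ)) * scaledLimit b x r e i j).det
      = c * ((∏ i ∈ Finset.range r, (Real.Gamma (b - i))⁻¹) *
        ∏ j ∈ Finset.range (e + s), (Real.Gamma (x + r + j))⁻¹) := by
  set F : ℕ → ℕ → ℝ := fun i j =>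
    (ascPochhammer ℝ i).eval (x + j) * scaledLimit b x r e i j with hF
  obtain ⟨c₁, hc₁, h₁⟩ := det_beta_block hneg hbn
  have hsplit : (Matrix.of fun i j : Fin (r + e + s) => F i j).det
      = (Matrix.of fun i j : Fin r => F i j).det *
        (Matrix.of fun i j : Fin e => F (r + i) (r + j)).det *
        (Matrix.of fun i j : Fin s => F (r + e + i) (r + e + j)).det := by
    rw [det_of_upper_right_zero F (r + e) s, det_of_upper_right_zero F r e]
    · intro i j hi hj
      simp [hF, scaledLimit, hi, hj.not_gt]
    · intro i j hi hj
      have : ¬ j < r := by omega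
      simp [hF, scaledLimit, hi, hj.not_gt, this]
  have htop : (Matrix.of fun i j : Fin r => F i j).det
      = c₁ * ∏ i ∈ Finset.range r, (Real.Gamma (b - i))⁻¹ := by
    rw [← h₁]
    congr 1
    ext i j
    simp [hF, scaledLimit]
  have hmid : ∃ c₂ > 0, (Matrix.of fun i j : Fin e => F (r + i) (r + j)).det
      = c₂ * ∏ j ∈ Finset.range e, (Real.Gamma (x + r + j))⁻¹ := by
    rcases Nat.le_one_iff_eq_zero_or_eq_one.1 he with rfl | rfl
    · exact ⟨1, one_pos, by simp⟩
    · refine ⟨Real.Gamma b, Real.Gamma_pos_of_pos hb, ?_⟩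
      have h := Gamma_add_natCast (hxn r) r
      rw [show x + r + r = b by linarith [hzero rfl]] at h
      rw [h]
      simp [hF, scaledLimit, Real.Gamma_ne_zero (hxn r)]
  have hbot : ∃ c₃ > 0, (Matrix.of fun i j : Fin s => F (r + e + i) (r + e + j)).det
      = c₃ * ∏ j ∈ Finset.range s, (Real.Gamma (x + r + (e + j : ℕ)))⁻¹ := by
    refine ⟨_, det_hankel_Gamma_pos hpos s, ?_⟩
    rw [mul_comm, ← Fin.prod_univ_eq_prod_range (fun j => (Real.Gamma (x + r + (e + j : ℕ)))⁻¹),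
      ← Matrix.det_mul_row]
    congr 1
    ext i j
    have hx := hxn (r + e + j)
    have hG := Gamma_add_natCast hx (r + e + i)
    have hG0 := Real.Gamma_ne_zero hx
    have hG1 : Real.Gamma (x + (r + e + j : ℕ) + (r + e + i : ℕ)) ≠ 0 := by
      refine Real.Gamma_ne_zero ?_
      rw [add_assoc, ← Nat.cast_add]
      exact hxn _
    simp only [hF, scaledLimit, Matrix.of_apply]
    rw [if_neg (by omega), if_neg (by omega), if_neg (by omega), if_neg (by omega),
      add_right_comm x, hG,
      show x + r + (e + j : ℕ) = x + (r + e + j : ℕ) by push_cast; ring,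
      show x - b + (r + e + i : ℕ) + (r + e + j : ℕ) = x - b + 2 * (r + e) + i + j by
        push_cast; ring]
    rw [hG] at hG1
    have hP := left_ne_zero_of_mul hG1
    field_simp
  obtain ⟨c₂, hc₂, h₂⟩ := hmid
  obtain ⟨c₃, hc₃, h₃⟩ := hbot
  refine ⟨c₁ * c₂ * c₃, by positivity, ?_⟩
  rw [hsplit, htop, h₂, h₃, Finset.prod_range_add]
  ring

/-- Divergence of the Hankel determinant once the sign of its leading coefficient is known. -/
lemma tendsto_hankelD_atBot_of_prod_neg {n s : ℕ} {d : ℝ} (hb : 0 < b)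
    (hbn : ∀ i m : ℕ, b - i ≠ -m) (hxn : ∀ i m : ℕ, d - n + i ≠ -m) (he : e ≤ 1)
    (hneg : ∀ p : ℕ, p + 2 ≤ 2 * r → d - n - b + p < 0)
    (hzero : e = 1 → d - n - b + 2 * r = 0) (hpos : 0 < d - n - b + 2 * (r + e))
    (hn : n + 1 = r + e + s) (hre : 0 < r + e)
    (hprod : (∏ i ∈ Finset.range r, (Real.Gamma (b - i))⁻¹) *
        ∏ j ∈ Finset.range (e + s), (Real.Gamma (d - n + r + j))⁻¹ < 0) :
    Tendsto (hankelD n b d) (nhdsWithin 0 (Ioi 0)) atBot := by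
  set x := d - n with hx
  obtain ⟨c, hc, hdet⟩ := det_scaledLimit hb hbn hxn he hneg hzero hpos s
  rw [← hn] at hdet
  set g : Fin (n + 1) → ℝ → ℝ := fun i => scaleFactor b x r e i with hg
  have hgpos : ∀ᶠ z in nhdsWithin 0 (Ioi 0), ∀ i, 0 < g i z := by
    filter_upwards [eventually_scaleFactor_pos (x := x) (r := r) (e := e) hb] with z h i
    exact h i
  have hprod0 : Tendsto (fun z => ∏ i, g i z) (nhdsWithin 0 (Ioi 0)) (nhds 0) := by
    have h := tendsto_finsetProd Finset.univ
      (fun (i : Fin (n + 1)) _ => tendsto_scaleFactor (e := e) hb hneg i)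
    rwa [Finset.prod_eq_zero (Finset.mem_univ 0) (by simp [hre])] at h
  have hinv : Tendsto (fun z => ((∏ i, g i z) * ∏ i, g i z)⁻¹) (nhdsWithin 0 (Ioi 0)) atTop := by
    refine Tendsto.inv_tendsto_nhdsGT_zero (tendsto_nhdsWithin_iff.2 ⟨?_, ?_⟩)
    · simpa using hprod0.mul hprod0
    · filter_upwards [hgpos] with z hz
      have := Finset.prod_pos fun i (_ : i ∈ Finset.univ) => hz i
      exact mul_pos this this
  set M : ℝ → Matrix (Fin (n + 1)) (Fin (n + 1)) ℝ := fun z => Matrix.of fun i j =>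
    (ascPochhammer ℝ (i : ℕ)).eval (x + (j : ℕ)) *
      tricomiF b (x + (i : ℕ) + (j : ℕ)) z with hM
  have hscaled : Tendsto (fun z => (Matrix.of fun i j => g i z * (Matrix.of fun i j =>
      g j z * M z i j) i j).det) (nhdsWithin 0 (Ioi 0))
      (nhds (c * ((∏ i ∈ Finset.range r, (Real.Gamma (b - i))⁻¹) *
        ∏ j ∈ Finset.range (e + s), (Real.Gamma (x + r + j))⁻¹))) := by
    rw [← hdet]
    refine (continuous_id.matrix_det.tendsto _).comp
      (tendsto_pi_nhds.2 fun i => tendsto_pi_nhds.2 fun j => ?_)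
    refine ((tendsto_scaled_tricomiF hb he hneg hzero hpos i j).const_mul
      ((ascPochhammer ℝ (i : ℕ)).eval (x + (j : ℕ)))).congr fun z => ?_
    simp only [hM, hg, Matrix.of_apply]
    ring
  refine (hscaled.neg_mul_atTop (mul_neg_of_pos_of_neg hc hprod) hinv).congr' ?_
  filter_upwards [hgpos] with z hz
  have := (Finset.prod_pos fun i (_ : i ∈ Finset.univ) => hz i).ne'
  rw [Matrix.det_mul_column, Matrix.det_mul_row]
  change _ = (M z).det
  field_simp

end Scaling

lemma Gamma_neg_of_mem_Ioo {y : ℝ} (h1 : -1 < y) (h2 : y < 0) : Real.Gamma y < 0 := by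
  have h := Real.Gamma_add_one h2.ne
  have hp := Real.Gamma_pos_of_pos (show 0 < y + 1 by linarith)
  rw [h] at hp
  exact neg_of_mul_pos_right hp h2.le

lemma ne_intCast_of_mem_Ioo {y : ℝ} {k : ℤ} (h1 : (k : ℝ) - 1 < y) (h2 : y < k) (m : ℤ) :
    y ≠ m := by
  rintro rfl
  have h1' : k - 1 < m := by exact_mod_cast h1
  have h2' : m < k := by exact_mod_cast h2
  omega

end

/-- If `(d,b)` belongs to the lower staircase region `E_n^-`, i.e. there is
`k ∈ {0,…,n-1}` with `k-1 < d < k` and `n-k-1 < b < n-k`, then `D^n_{b,d}(z) → -∞`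
as `z → 0+`. -/
theorem hankelD_tendsto_atBot_lower_staircase (n : ℕ) (hn : 1 ≤ n) (b d : ℝ)
    (h : ∃ k : ℕ, k < n ∧ (k : ℝ) - 1 < d ∧ d < (k : ℝ) ∧
      (n : ℝ) - (k : ℝ) - 1 < b ∧ b < (n : ℝ) - (k : ℝ)) :
    Tendsto (fun z => hankelD n b d z) (nhdsWithin 0 (Set.Ioi 0)) atBot := by
  obtain ⟨k, hk, hd1, hd2, hb1, hb2⟩ := h
  obtain ⟨q, rfl⟩ := Nat.exists_eq_add_of_lt hk
  have hq : ((k + q + 1 : ℕ) : ℝ) - k = ((q + 1 : ℕ) : ℝ) := by push_cast; ring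
  rw [hq] at hb1 hb2
  push_cast at hb1 hb2
  have hq0 : (0 : ℝ) ≤ q := q.cast_nonneg
  have hb : 0 < b := by linarith
  have hbn : ∀ i m : ℕ, b - i ≠ -m := fun i m hm =>
    ne_intCast_of_mem_Ioo (y := b) (k := q + 1) (by push_cast; linarith) (by push_cast; linarith)
      (i - m) (by push_cast; linarith)
  have hxn : ∀ i m : ℕ, d - (k + q + 1 : ℕ) + i ≠ -m := fun i m hm =>
    ne_intCast_of_mem_Ioo (y := d) (k := k) (by push_cast; linarith) (by push_cast; linarith)
      ((k + q + 1 : ℕ) - i - m) (by push_cast at hm ⊢; linarith)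
  have hp1 : 0 < ∏ i ∈ Finset.range (q + 1), (Real.Gamma (b - i))⁻¹ := by
    refine Finset.prod_pos fun i hi => inv_pos.2 (Real.Gamma_pos_of_pos ?_)
    have : (i : ℝ) ≤ q := by exact_mod_cast Nat.lt_succ_iff.1 (Finset.mem_range.1 hi)
    linarith
  have hp2 : 0 < ∏ j ∈ Finset.range k, (Real.Gamma (d - k + 1 + j))⁻¹ :=
    Finset.prod_pos fun j _ => inv_pos.2 (Real.Gamma_pos_of_pos (by
      have : (0 : ℝ) ≤ j := j.cast_nonneg
      linarith))
  have hn1 : (Real.Gamma (b - (q + 1 : ℕ)))⁻¹ < 0 :=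
    inv_lt_zero.2 (Gamma_neg_of_mem_Ioo (by push_cast; linarith) (by push_cast; linarith))
  have hn2 : (Real.Gamma (d - k))⁻¹ < 0 :=
    inv_lt_zero.2 (Gamma_neg_of_mem_Ioo (by linarith) (by linarith))
  have hprod : (∏ i ∈ Finset.range (q + 1), (Real.Gamma (b - i))⁻¹) *
      ∏ j ∈ Finset.range (k + 1),
        (Real.Gamma (d - (k + q + 1 : ℕ) + (q + 1 : ℕ) + j))⁻¹ < 0 := by
    refine mul_neg_of_pos_of_neg hp1 ?_
    have hcongr : ∀ j : ℕ, d - (k + q + 1 : ℕ) + (q + 1 : ℕ) + (j + 1 : ℕ) = d - k + 1 + j := by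
      intro j; push_cast; ring
    rw [Finset.prod_range_succ', Finset.prod_congr rfl fun j _ => by rw [hcongr j],
      show d - (k + q + 1 : ℕ) + (q + 1 : ℕ) + ((0 : ℕ) : ℝ) = d - k by push_cast; ring]
    exact mul_neg_of_pos_of_neg hp2 hn2
  rcases lt_trichotomy (d - (k + q + 1 : ℕ) - b + 2 * (q + 1 : ℕ)) 0 with hs | hs | hs
  · refine tendsto_hankelD_atBot_of_prod_neg (r := q + 2) (e := 0) (s := k) hb hbn hxn zero_le_one
      (fun p hp => ?_) (by simp) ?_ (by ring) (by omega) ?_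
    · have : (p : ℝ) ≤ 2 * (q + 1 : ℕ) := by exact_mod_cast (show p ≤ 2 * (q + 1) by omega)
      linarith
    · push_cast
      linarith
    · have hcongr : ∀ j : ℕ, d - (k + q + 1 : ℕ) + (q + 2 : ℕ) + j = d - k + 1 + j := by
        intro j; push_cast; ring
      simp only [hcongr]
      rw [Finset.prod_range_succ, zero_add]
      exact mul_neg_of_neg_of_pos (mul_neg_of_pos_of_neg hp1 hn1) hp2
  · refine tendsto_hankelD_atBot_of_prod_neg (r := q + 1) (e := 1) (s := k) hb hbn hxn le_rfl
      (fun p hp => ?_) (fun _ => hs) ?_ (by ring) (by omega) ?_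
    · have : (p : ℝ) ≤ 2 * q := by exact_mod_cast (show p ≤ 2 * q by omega)
      push_cast at hs ⊢
      linarith
    · push_cast at hs ⊢
      linarith
    · rw [add_comm 1 k]
      exact hprod
  · refine tendsto_hankelD_atBot_of_prod_neg (r := q + 1) (e := 0) (s := k + 1) hb hbn hxn
      zero_le_one (fun p hp => ?_) (by simp) (by simpa using hs) (by ring) (by omega) ?_
    · have : (p : ℝ) ≤ 2 * q := by exact_mod_cast (show p ≤ 2 * q by omega)
      push_cast at hd2 ⊢
      linarith
    · rw [zero_add]
      exact hprod
end

section
/- (Turán-type inequality, Corollary 1.) Let a > 0 and c ∈ ℝ with a ≥ 1 or c ≤ a + 2. Then for every x > 0, Ψ(a, c−1, x)·Ψ(a, c+1, x) − Ψ(a, c, x)² ≤ (1/x)·Ψ(a, c, x)·Ψ(a, c−1, x). -/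
/-- The Tricomi confluent hypergeometric function of the second kind,
`Ψ(a, c, x) = (1/Γ(a)) ∫₀^∞ e^{-tx} t^{a-1} (1+t)^{c-a-1} dt`. -/
noncomputable def Psi (a c x : ℝ) : ℝ :=
  (1 / Real.Gamma a) * ∫ t in Set.Ioi (0:ℝ),
    Real.exp (-t * x) * t ^ (a - 1) * (1 + t) ^ (c - a - 1)

open MeasureTheory Set Filter Topology

/-- The integrand `e^{-tx} t^α (1+t)^β`. -/
noncomputable def tricomiKernel (x α β t : ℝ) : ℝ :=
  Real.exp (-t * x) * t ^ α * (1 + t) ^ β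

/-- The integral of `e^{-tx} t^α (1+t)^β` over `(0, ∞)`. -/
noncomputable def tricomiIntegral (x α β : ℝ) : ℝ :=
  ∫ t in Ioi (0 : ℝ), tricomiKernel x α β t

lemma tricomiKernel_pos {x α β t : ℝ} (ht : 0 < t) : 0 < tricomiKernel x α β t := by
  unfold tricomiKernel; positivity

lemma tricomiKernel_add_one_left {x α β t : ℝ} (ht : 0 < t) :
    tricomiKernel x (α + 1) β t = t * tricomiKernel x α β t := by
  unfold tricomiKernel
  rw [Real.rpow_add_one ht.ne']
  ring

lemma tricomiKernel_add_one_right {x α β t : ℝ} (ht : 0 < t) :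
    tricomiKernel x α (β + 1) t = (1 + t) * tricomiKernel x α β t := by
  unfold tricomiKernel
  rw [Real.rpow_add_one (by positivity)]
  ring

lemma integrableOn_tricomiKernel_natCast {x : ℝ} (hx : 0 < x) (n : ℕ) :
    ∀ {α : ℝ}, -1 < α → IntegrableOn (tricomiKernel x α n) (Ioi 0) := by
  induction n with
  | zero =>
    intro α hα
    refine (integrableOn_rpow_mul_exp_neg_mul_rpow hα zero_lt_one hx).congr_fun
      (fun t _ ↦ ?_) measurableSet_Ioi
    simp only [tricomiKernel, Nat.cast_zero, Real.rpow_zero, Real.rpow_one, mul_one]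
    rw [mul_comm, neg_mul, neg_mul, mul_comm x]
  | succ n ih =>
    intro α hα
    refine ((ih hα).add (ih (α := α + 1) (by linarith))).congr_fun
      (fun t ht ↦ ?_) measurableSet_Ioi
    rw [Pi.add_apply, tricomiKernel_add_one_left ht, Nat.cast_succ,
      tricomiKernel_add_one_right ht]
    ring

lemma integrableOn_tricomiKernel {x α : ℝ} (hx : 0 < x) (hα : -1 < α) (β : ℝ) :
    IntegrableOn (tricomiKernel x α β) (Ioi 0) := by
  obtain ⟨n, hn⟩ := exists_nat_ge β
  refine (integrableOn_tricomiKernel_natCast hx n hα).mono' ?_ ?_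
  · unfold tricomiKernel
    exact Measurable.aestronglyMeasurable (by fun_prop)
  · refine (ae_restrict_iff' measurableSet_Ioi).2 (ae_of_all _ fun t ht ↦ ?_)
    have ht : 0 < t := ht
    rw [Real.norm_of_nonneg (tricomiKernel_pos ht).le]
    unfold tricomiKernel
    gcongr
    linarith

lemma tricomiIntegral_pos {x α : ℝ} (hx : 0 < x) (hα : -1 < α) (β : ℝ) :
    0 < tricomiIntegral x α β := by
  refine (setIntegral_pos_iff_support_of_nonneg_ae ?_ (integrableOn_tricomiKernel hx hα β)).2 ?_
  · exact (ae_restrict_iff' measurableSet_Ioi).2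
      (ae_of_all _ fun t ht ↦ (tricomiKernel_pos ht).le)
  · have : Ioi 0 ⊆ Function.support (tricomiKernel x α β) :=
      fun t ht ↦ (tricomiKernel_pos ht).ne'
    rw [inter_eq_right.2 this]
    simp

lemma tricomiIntegral_add_one_right {x α : ℝ} (hx : 0 < x) (hα : -1 < α) (β : ℝ) :
    tricomiIntegral x α (β + 1) = tricomiIntegral x α β + tricomiIntegral x (α + 1) β := by
  unfold tricomiIntegral
  rw [← integral_add (integrableOn_tricomiKernel hx hα β)
    (integrableOn_tricomiKernel hx (by linarith) β)]
  refine setIntegral_congr_fun measurableSet_Ioi fun t ht ↦ ?_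
  simp only [tricomiKernel_add_one_left (mem_Ioi.1 ht),
    tricomiKernel_add_one_right (mem_Ioi.1 ht)]
  ring

lemma sq_setIntegral_le_mul_setIntegral {u v w : ℝ → ℝ} {s : Set ℝ} (hs : MeasurableSet s)
    (hu : IntegrableOn u s) (hv : IntegrableOn v s) (hw : IntegrableOn w s)
    (hu0 : ∀ t ∈ s, 0 < u t) (h : ∀ t ∈ s, v t ^ 2 ≤ u t * w t) :
    (∫ t in s, v t) ^ 2 ≤ (∫ t in s, u t) * ∫ t in s, w t := by
  have key (r : ℝ) : 0 ≤ (∫ t in s, u t) * (r * r) + (-2 * ∫ t in s, v t) * r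
      + ∫ t in s, w t := by
    have : 0 ≤ ∫ t in s, (u t * (r * r) + v t * (-2 * r) + w t) := by
      refine setIntegral_nonneg hs fun t ht ↦ ?_
      refine nonneg_of_mul_nonneg_right ?_ (hu0 t ht)
      nlinarith [sq_nonneg (u t * r - v t), h t ht]
    rw [integral_add (f := fun t ↦ u t * (r * r) + v t * (-2 * r)) ((hu.mul_const _).add (hv.mul_const _)) hw,
      integral_add (hu.mul_const _) (hv.mul_const _), integral_mul_const,
      integral_mul_const] at this
    linarith
  have := discrim_le_zero key
  unfold discrim at this
  linarith

lemma sq_tricomiIntegral_le_left {x α : ℝ} (hx : 0 < x) (hα : -1 < α) (β : ℝ) :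
    tricomiIntegral x (α + 1) β ^ 2
      ≤ tricomiIntegral x α β * tricomiIntegral x (α + 1 + 1) β := by
  refine sq_setIntegral_le_mul_setIntegral measurableSet_Ioi
    (integrableOn_tricomiKernel hx hα β) (integrableOn_tricomiKernel hx (by linarith) β)
    (integrableOn_tricomiKernel hx (by linarith) β) (fun t ht ↦ tricomiKernel_pos ht)
    fun t ht ↦ le_of_eq ?_
  simp only [tricomiKernel_add_one_left (mem_Ioi.1 ht)]
  ring

lemma sq_tricomiIntegral_le_right {x α : ℝ} (hx : 0 < x) (hα : -1 < α) (β : ℝ) :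
    tricomiIntegral x α (β + 1) ^ 2
      ≤ tricomiIntegral x α β * tricomiIntegral x α (β + 1 + 1) := by
  refine sq_setIntegral_le_mul_setIntegral measurableSet_Ioi
    (integrableOn_tricomiKernel hx hα β) (integrableOn_tricomiKernel hx hα _)
    (integrableOn_tricomiKernel hx hα _) (fun t ht ↦ tricomiKernel_pos ht)
    fun t ht ↦ le_of_eq ?_
  simp only [tricomiKernel_add_one_right (mem_Ioi.1 ht)]
  ring

lemma hasDerivAt_tricomiKernel {x α β t : ℝ} (ht : 0 < t) :
    HasDerivAt (tricomiKernel x α β)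
      (α * tricomiKernel x (α - 1) β t + β * tricomiKernel x α (β - 1) t
        - x * tricomiKernel x α β t) t := by
  have h₁ : HasDerivAt (fun t : ℝ ↦ Real.exp (-t * x)) (Real.exp (-t * x) * (-1 * x)) t :=
    ((hasDerivAt_id t).neg.mul_const x).exp
  have h₂ : HasDerivAt (fun t : ℝ ↦ t ^ α) (α * t ^ (α - 1)) t :=
    Real.hasDerivAt_rpow_const (Or.inl ht.ne')
  have h₃ : HasDerivAt (fun t : ℝ ↦ (1 + t) ^ β) (1 * β * (1 + t) ^ (β - 1)) t :=
    ((hasDerivAt_id t).const_add 1).rpow_const (Or.inl (by simp; positivity))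
  refine ((h₁.mul h₂).mul h₃).congr_deriv ?_
  simp only [tricomiKernel, Pi.mul_apply]
  ring

lemma continuousWithinAt_tricomiKernel {x α : ℝ} (hα : 0 ≤ α) (β : ℝ) :
    ContinuousWithinAt (tricomiKernel x α β) (Ici 0) 0 := by
  have h₂ : ContinuousAt (fun t : ℝ ↦ t ^ α) 0 := Real.continuousAt_rpow_const _ _ (Or.inr hα)
  have h₃ : ContinuousAt (fun t : ℝ ↦ (1 + t) ^ β) 0 :=
    ContinuousAt.rpow_const (by fun_prop) (Or.inl (by simp))
  have h₁ : ContinuousAt (fun t : ℝ ↦ Real.exp (-t * x)) 0 := by fun_prop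
  exact ((h₁.mul h₂).mul h₃).continuousWithinAt

/-- Integration by parts; the boundary term at the origin is `0 ^ α`. -/
lemma mul_tricomiIntegral_eq {x α : ℝ} (hx : 0 < x) (hα : 0 ≤ α) (β : ℝ) :
    x * tricomiIntegral x α β
      = 0 ^ α + α * tricomiIntegral x (α - 1) β + β * tricomiIntegral x α (β - 1) := by
  have i₀ := integrableOn_tricomiKernel hx (show -1 < α by linarith) β
  have i₁ : IntegrableOn (fun t ↦ α * tricomiKernel x (α - 1) β t) (Ioi 0) := by
    rcases hα.eq_or_lt with rfl | h
    · simp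
    · exact (integrableOn_tricomiKernel hx (by linarith) β).const_mul α
  have i₂ := (integrableOn_tricomiKernel hx (show -1 < α by linarith) (β - 1)).const_mul β
  have hd : ∀ t ∈ Ioi (0 : ℝ), HasDerivAt (tricomiKernel x α β) _ t :=
    fun t ht ↦ hasDerivAt_tricomiKernel ht
  have hi := (i₁.add i₂).sub (i₀.const_mul x)
  have h := integral_Ioi_of_hasDerivAt_of_tendsto (continuousWithinAt_tricomiKernel hα β) hd hi
    (tendsto_zero_of_hasDerivAt_of_integrableOn_Ioi hd hi i₀)
  rw [integral_sub (f := fun t ↦ α * tricomiKernel x (α - 1) β t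
    + β * tricomiKernel x α (β - 1) t) (i₁.add i₂) (i₀.const_mul x), integral_add i₁ i₂, integral_const_mul,
    integral_const_mul, integral_const_mul] at h
  have h0 : tricomiKernel x α β 0 = 0 ^ α := by simp [tricomiKernel]
  rw [h0] at h
  unfold tricomiIntegral
  linarith

/-- The Turán-type inequality after eliminating `tricomiIntegral x (a - 1) (b + 1)` by parts. -/
lemma tricomiIntegral_turan {x a b : ℝ} (hx : 0 < x) (ha : 0 < a) (h : 1 ≤ a ∨ b ≤ 1) :
    (a - 1) * (tricomiIntegral x (a - 1) b * tricomiIntegral x (a - 1) (b - 1))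
      ≤ (tricomiIntegral x (a - 1) b - tricomiIntegral x (a - 1) (b - 1))
        * (x * tricomiIntegral x (a - 1) b - b * tricomiIntegral x (a - 1) (b - 1)) := by
  have ha' : -1 < a - 1 := by linarith
  have e₁ := tricomiIntegral_add_one_right hx ha' (b - 1)
  rw [sub_add_cancel, sub_add_cancel] at e₁
  have p₂ := tricomiIntegral_pos hx (show -1 < a by linarith) (b - 1)
  rcases h with h | h
  · have ibp := mul_tricomiIntegral_eq hx (sub_nonneg.2 h) b
    rcases h.eq_or_lt with rfl | h
    · simp only [sub_self, zero_mul, Real.rpow_zero, add_zero] at ibp e₁ p₂ ⊢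
      rw [ibp, e₁]
      linarith
    · have ha₂ : -1 < a - 1 - 1 := by linarith
      rw [Real.zero_rpow (by linarith)] at ibp
      have e₂ := tricomiIntegral_add_one_right hx ha₂ (b - 1)
      have cs := sq_tricomiIntegral_le_left hx ha₂ (b - 1)
      rw [sub_add_cancel, sub_add_cancel] at e₂
      rw [sub_add_cancel, sub_add_cancel] at cs
      rw [ibp, e₂, e₁]
      nlinarith [mul_le_mul_of_nonneg_left cs (sub_nonneg.2 h.le)]
  · have ibp := mul_tricomiIntegral_eq hx ha.le (b - 1)
    rw [Real.zero_rpow ha.ne'] at ibp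
    have e₂ := tricomiIntegral_add_one_right hx ha' (b - 1 - 1)
    have cs := sq_tricomiIntegral_le_right hx ha' (b - 1 - 1)
    rw [sub_add_cancel, sub_add_cancel] at e₂
    rw [sub_add_cancel, sub_add_cancel] at cs
    have cs' := mul_le_mul_of_nonneg_left cs (sub_nonneg.2 h)
    have e₃ : x * (tricomiIntegral x (a - 1) b - tricomiIntegral x (a - 1) (b - 1))
        = a * tricomiIntegral x (a - 1) (b - 1) + (b - 1) *
          (tricomiIntegral x (a - 1) (b - 1) - tricomiIntegral x (a - 1) (b - 1 - 1)) := by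
      rw [e₁, add_sub_cancel_left, ibp, e₂]
      ring
    linear_combination cs' - tricomiIntegral x (a - 1) b * e₃
      + sq_nonneg (tricomiIntegral x (a - 1) (b - 1))

/-- Turán-type inequality (Corollary 1): for `a ≥ 1` or `c ≤ a + 2`,
`Ψ(a,c-1)Ψ(a,c+1) - Ψ(a,c)² ≤ (1/x) Ψ(a,c) Ψ(a,c-1)` on `(0,∞)`. -/
theorem psi_turan_inequality_one (a c : ℝ) (ha : 0 < a) (h : 1 ≤ a ∨ c ≤ a + 2)
    (x : ℝ) (hx : 0 < x) :
    Psi a (c - 1) x * Psi a (c + 1) x - (Psi a c x) ^ 2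
      ≤ (1 / x) * Psi a c x * Psi a (c - 1) x := by
  obtain ⟨b, rfl⟩ : ∃ b, c = b + a + 1 := ⟨c - a - 1, by ring⟩
  have hΨ (d : ℝ) : Psi a (d + a + 1) x = 1 / Real.Gamma a * tricomiIntegral x (a - 1) d := by
    simp only [Psi, tricomiIntegral, tricomiKernel]
    rw [show d + a + 1 - a - 1 = d by ring]
  rw [show b + a + 1 - 1 = (b - 1) + a + 1 by ring,
    show b + a + 1 + 1 = (b + 1) + a + 1 by ring, hΨ, hΨ, hΨ]
  have key := tricomiIntegral_turan (b := b) hx ha (h.imp_right fun h ↦ by linarith)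
  have e₁ := tricomiIntegral_add_one_right hx (show -1 < a - 1 by linarith) (b - 1)
  have e₂ := tricomiIntegral_add_one_right hx (show -1 < a - 1 by linarith) b
  have ibp := mul_tricomiIntegral_eq hx ha.le b
  rw [Real.zero_rpow ha.ne'] at ibp
  rw [sub_add_cancel, sub_add_cancel] at e₁
  rw [sub_add_cancel] at e₂
  rw [← sub_eq_iff_eq_add'.2 e₁, ← sub_eq_iff_eq_add'.2 e₂] at ibp
  set J₀ := tricomiIntegral x (a - 1) (b - 1)
  set J₁ := tricomiIntegral x (a - 1) b
  set J₂ := tricomiIntegral x (a - 1) (b + 1)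
  have main : J₀ * J₂ - J₁ ^ 2 ≤ 1 / x * J₁ * J₀ := by
    rw [one_div, mul_assoc, inv_mul_eq_div, le_div_iff₀ hx]
    linear_combination key + J₀ * ibp
  linear_combination (1 / Real.Gamma a) ^ 2 * main
end
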